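/- Let A(x) = (a_{ij}(x)) be a symmetric n×n matrix with C^∞ entries, positive semidefinite at every point and with Σᵢ a_{ii}(x) > 0 for every x ∈ ℝⁿ, and let L u = Σ_{i,j} ∂_i(a_{ij} ∂_j u). Let Γ be smooth on {x ≠ y} and satisfy hypotheses (i)–(iv); fix α > −1 and define Ω_r(x), K(x,y), M_r, N_r, Q_r as below. Assume: (a) for every u ∈ C²(ℝⁿ, ℝ), every x ∈ ℝⁿ and every r > 0, u(x) = M_r(u)(x) − N_r(Lu)(x); (b) for every g ∈ C_c^∞(ℝⁿ, ℝ), the potential u_g(x) := ∫_{ℝⁿ} Γ(x,y) g(y) dy is C^∞ and satisfies L u_g = −g pointwise; (c) sup_{x∈G} ∫_K Γ(x,y) dy < ∞ for all compact sets G, K ⊆ ℝⁿ. Then for every compactly supported continuous f : ℝⁿ → ℝ, the potential u_f(x) := ∫_{ℝⁿ} Γ(x,y) f(y) dy satisfies the representation u_f(x) = M_r(u_f)(x) + N_r(f)(x) for every x ∈ ℝⁿ and every r > 0. -/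

import Mathlib

open MeasureTheory Filter Topology Metric

/-- The `L`-ball `Ω_r(x) := {y ≠ x : Γ(x,y) > 1/r} ∪ {x}`. -/
def LBall {n : ℕ} (Γ : EuclideanSpace ℝ (Fin n) → EuclideanSpace ℝ (Fin n) → ℝ)
    (x : EuclideanSpace ℝ (Fin n)) (r : ℝ) : Set (EuclideanSpace ℝ (Fin n)) :=
  {y | y ≠ x ∧ 1 / r < Γ x y} ∪ {x}

/-- The partial derivative `∂_i g` in the `i`-th coordinate direction. -/
noncomputable def pd {n : ℕ} (i : Fin n) (g : EuclideanSpace ℝ (Fin n) → ℝ)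
    (x : EuclideanSpace ℝ (Fin n)) : ℝ :=
  fderiv ℝ g x (EuclideanSpace.single i 1)

/-- The divergence-form operator `L u = Σ_{i,j} ∂_i (a_{ij} ∂_j u)`. -/
noncomputable def Lop {n : ℕ} (A : EuclideanSpace ℝ (Fin n) → Matrix (Fin n) (Fin n) ℝ)
    (u : EuclideanSpace ℝ (Fin n) → ℝ) (x : EuclideanSpace ℝ (Fin n)) : ℝ :=
  ∑ i : Fin n, ∑ j : Fin n, pd i (fun z => A z i j * pd j u z) x

/-- The kernel `K(x,y) = ⟨A(y)∇_yΓ(x,y), ∇_yΓ(x,y)⟩ / Γ(x,y)^{α+2}`. -/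
noncomputable def Kker {n : ℕ} (Γ : EuclideanSpace ℝ (Fin n) → EuclideanSpace ℝ (Fin n) → ℝ)
    (A : EuclideanSpace ℝ (Fin n) → Matrix (Fin n) (Fin n) ℝ) (α : ℝ)
    (x y : EuclideanSpace ℝ (Fin n)) : ℝ :=
  (∑ i : Fin n, ∑ j : Fin n, A y i j * pd i (fun z => Γ x z) y * pd j (fun z => Γ x z) y)
    / Γ x y ^ (α + 2)

/-- `M_r(u)(x) := ((α+1)/r^{α+1}) ∫_{Ω_r(x)} u(y) K(x,y) dy`. -/
noncomputable def Mr {n : ℕ} (Γ : EuclideanSpace ℝ (Fin n) → EuclideanSpace ℝ (Fin n) → ℝ)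
    (A : EuclideanSpace ℝ (Fin n) → Matrix (Fin n) (Fin n) ℝ) (α : ℝ)
    (u : EuclideanSpace ℝ (Fin n) → ℝ) (x : EuclideanSpace ℝ (Fin n)) (r : ℝ) : ℝ :=
  ((α + 1) / r ^ (α + 1)) * ∫ y in LBall Γ x r, u y * Kker Γ A α x y

/-- `N_r(w)(x) := ((α+1)/r^{α+1}) ∫₀^r ρ^α (∫_{Ω_ρ(x)} (Γ(x,y) − 1/ρ) w(y) dy) dρ`. -/
noncomputable def Nr {n : ℕ} (Γ : EuclideanSpace ℝ (Fin n) → EuclideanSpace ℝ (Fin n) → ℝ)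
    (α : ℝ) (w : EuclideanSpace ℝ (Fin n) → ℝ) (x : EuclideanSpace ℝ (Fin n)) (r : ℝ) : ℝ :=
  ((α + 1) / r ^ (α + 1)) *
    ∫ ρ in (0 : ℝ)..r, ρ ^ α * ∫ y in LBall Γ x ρ, (Γ x y - 1 / ρ) * w y

/-- `Q_r(x) := N_r(1)(x)`. -/
noncomputable def Qr {n : ℕ} (Γ : EuclideanSpace ℝ (Fin n) → EuclideanSpace ℝ (Fin n) → ℝ)
    (α : ℝ) (x : EuclideanSpace ℝ (Fin n)) (r : ℝ) : ℝ :=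
  Nr Γ α (fun _ => 1) x r

/-- The potential `u_g(x) := ∫_{ℝⁿ} Γ(x,y) g(y) dy`. -/
noncomputable def potential {n : ℕ}
    (Γ : EuclideanSpace ℝ (Fin n) → EuclideanSpace ℝ (Fin n) → ℝ)
    (g : EuclideanSpace ℝ (Fin n) → ℝ) (x : EuclideanSpace ℝ (Fin n)) : ℝ :=
  ∫ y, Γ x y * g y

lemma measurable_of_continuousOn_ne {X : Type*} [TopologicalSpace X] [T1Space X]
    [MeasurableSpace X] [BorelSpace X] {γ : X → ℝ} {x : X} (h : ContinuousOn γ {y | y ≠ x}) :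
    Measurable γ :=
  measurable_of_measurable_on_compl_singleton x
    (continuousOn_iff_continuous_domRestrict.1 h).measurable

lemma continuousOn_section {X : Type*} [TopologicalSpace X] {Γ : X → X → ℝ}
    (h : ContinuousOn (fun p : X × X => Γ p.1 p.2) {p | p.1 ≠ p.2}) (x : X) :
    ContinuousOn (Γ x) {y | y ≠ x} :=
  h.comp (f := fun y => (x, y)) (by fun_prop) fun _ hy => Ne.symm hy

lemma integrable_mul_of_support_subset {X : Type*} [TopologicalSpace X] [T2Space X]
    [MeasurableSpace X] [BorelSpace X] {μ : Measure X} {γ g : X → ℝ} {K : Set X} {M : ℝ}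
    (hγ : LocallyIntegrable γ μ) (hK : IsCompact K) (hgm : AEStronglyMeasurable g μ)
    (hgK : Function.support g ⊆ K) (hgM : ∀ y, |g y| ≤ M) :
    Integrable (fun y => γ y * g y) μ := by
  rw [← integrableOn_iff_integrable_of_support_subset (s := K)]
  · exact (hγ.integrableOn_isCompact hK).mul_bdd (c := M) hgm.restrict (.of_forall hgM)
  · exact (Function.support_mul_subset_right _ _).trans hgK

lemma abs_integral_mul_le_of_support_subset {X : Type*} [TopologicalSpace X] [T2Space X]
    [MeasurableSpace X] [BorelSpace X] {μ : Measure X} {γ g : X → ℝ} {K : Set X} {M : ℝ}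
    (hγ : LocallyIntegrable γ μ) (hγ0 : 0 ≤ᵐ[μ] γ) (hK : IsCompact K)
    (hgK : Function.support g ⊆ K) (hgM : ∀ y, |g y| ≤ M) :
    |∫ y, γ y * g y ∂μ| ≤ M * ∫ y in K, γ y ∂μ := by
  rw [← setIntegral_eq_integral_of_forall_compl_eq_zero (s := K)
    (fun y hy => by simp [Function.notMem_support.1 (mt (@hgK y) hy)]), ← integral_const_mul,
    ← Real.norm_eq_abs]
  refine norm_integral_le_of_norm_le ((hγ.integrableOn_isCompact hK).const_mul M) ?_
  filter_upwards [ae_restrict_of_ae hγ0] with y hy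
  rw [norm_mul, Real.norm_of_nonneg hy, mul_comm]
  exact mul_le_mul_of_nonneg_right (hgM y) hy

/-- A compactly supported continuous function is a uniform limit of smooth functions with the
same support, uniformly bounded. -/
lemma exists_smooth_approx {E : Type*} [NormedAddCommGroup E] [NormedSpace ℝ E]
    [FiniteDimensional ℝ E] {f : E → ℝ} (hf : Continuous f) (hfs : HasCompactSupport f) :
    ∃ (g : ℕ → E → ℝ) (M : ℝ), (∀ k, ContDiff ℝ (⊤ : ℕ∞) (g k)) ∧
      (∀ k, Function.support (g k) ⊆ tsupport f) ∧ (∀ k y, |g k y| ≤ M) ∧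
      ∀ y, Tendsto (fun k => g k y) atTop (𝓝 (f y)) := by
  obtain ⟨M, hM⟩ := hfs.exists_bound_of_continuous hf
  have h (k : ℕ) := hf.exists_contDiff_approx ⊤ (ε := fun _ : E => 1 / ((k : ℝ) + 1)) continuous_const
    fun _ => by positivity
  choose g hg hgf hgs using h
  refine ⟨g, M + 1, hg, fun k => (hgs k).trans subset_closure, fun k y => ?_, fun y => ?_⟩
  · have h1 : |g k y - f y| < 1 / ((k : ℝ) + 1) := hgf k y
    have h2 : 1 / ((k : ℝ) + 1) ≤ 1 := by
      rw [div_le_one (by positivity)]; linarith [(Nat.cast_nonneg k : (0 : ℝ) ≤ k)]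
    have h3 : |f y| ≤ M := hM y
    have h4 := abs_add_le (g k y - f y) (f y)
    rw [sub_add_cancel] at h4
    linarith
  · exact tendsto_iff_dist_tendsto_zero.2 <| squeeze_zero (fun _ => dist_nonneg)
      (fun k => (hgf k y).le) tendsto_one_div_add_atTop_nhds_zero_nat

section LBall

variable {n : ℕ} {Γ : EuclideanSpace ℝ (Fin n) → EuclideanSpace ℝ (Fin n) → ℝ}
  {x : EuclideanSpace ℝ (Fin n)}

lemma LBall_mono {ρ r : ℝ} (hρ : 0 < ρ) (h : ρ ≤ r) : LBall Γ x ρ ⊆ LBall Γ x r :=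
  Set.union_subset_union_left _ fun _ hy =>
    ⟨hy.1, (one_div_le_one_div_of_le hρ h).trans_lt hy.2⟩

lemma measurableSet_LBall_prod (hΓ : Measurable (Γ x)) :
    MeasurableSet {p : ℝ × EuclideanSpace ℝ (Fin n) | p.2 ∈ LBall Γ x p.1} := by
  have h1 : MeasurableSet {p : ℝ × EuclideanSpace ℝ (Fin n) | p.2 = x} :=
    measurable_snd (measurableSet_singleton x)
  have h2 : MeasurableSet {p : ℝ × EuclideanSpace ℝ (Fin n) | 1 / p.1 < Γ x p.2} :=
    measurableSet_lt (by fun_prop) (by fun_prop)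
  exact (h1.compl.inter h2).union h1

lemma measurableSet_LBall (hΓ : Measurable (Γ x)) (r : ℝ) : MeasurableSet (LBall Γ x r) :=
  measurable_prodMk_left (measurableSet_LBall_prod hΓ)

lemma LBall_subset_compact (hsymm : ∀ x y, x ≠ y → Γ x y = Γ y x)
    (hdecay : Tendsto (fun z => Γ z x) (cocompact _) (𝓝 0)) {r : ℝ} (hr : 0 < r) :
    ∃ G, IsCompact G ∧ LBall Γ x r ⊆ G := by
  obtain ⟨G, hG, hGs⟩ := mem_cocompact.1 (hdecay.eventually_lt_const (one_div_pos.2 hr))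
  refine ⟨insert x G, hG.insert x, ?_⟩
  rintro y (⟨hyx, hy⟩ | rfl)
  · by_contra hyG
    have : Γ y x < 1 / r := hGs fun h => hyG (Set.mem_insert_of_mem _ h)
    rw [hsymm y x hyx] at this
    exact lt_asymm hy this
  · exact Set.mem_insert _ _

lemma Nr_tendsto (hΓ : Measurable (Γ x)) (hloc : LocallyIntegrable (Γ x)) {G : Set _}
    (hG : IsCompact G) {α r : ℝ} (hα : -1 < α) (hr : 0 < r) (hGr : LBall Γ x r ⊆ G)
    (hae : ∀ᵐ y, y ≠ x)
    {g : ℕ → EuclideanSpace ℝ (Fin n) → ℝ} {f : EuclideanSpace ℝ (Fin n) → ℝ} {M : ℝ}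
    (hg : ∀ k, Measurable (g k)) (hM : ∀ k y, |g k y| ≤ M)
    (hlim : ∀ y, Tendsto (fun k => g k y) atTop (𝓝 (f y))) :
    Tendsto (fun k => Nr Γ α (g k) x r) atTop (𝓝 (Nr Γ α f x r)) := by
  have hbd {ρ : ℝ} (hρ : ρ ∈ Set.Ioc 0 r) (k : ℕ) :
      ∀ᵐ y ∂volume.restrict (LBall Γ x ρ), ‖(Γ x y - 1 / ρ) * g k y‖ ≤ |Γ x y| * M := by
    filter_upwards [ae_restrict_mem (measurableSet_LBall hΓ ρ), ae_restrict_of_ae hae]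
      with y hy hyx
    have hy' : 1 / ρ < Γ x y := (hy.resolve_right hyx).2
    have hρ' : 0 < 1 / ρ := one_div_pos.2 hρ.1
    rw [norm_mul]
    refine mul_le_mul ?_ (hM k y) (norm_nonneg _) (abs_nonneg _)
    rw [Real.norm_of_nonneg (by linarith), abs_of_pos (by linarith)]
    linarith
  have hint : IntegrableOn (fun y => |Γ x y| * M) G :=
    (hloc.integrableOn_isCompact hG).abs.mul_const M
  have hM0 : 0 ≤ M := (abs_nonneg _).trans (hM 0 x)
  have hsub {ρ : ℝ} (hρ : ρ ∈ Set.Ioc 0 r) : LBall Γ x ρ ⊆ G := (LBall_mono hρ.1 hρ.2).trans hGr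
  refine Tendsto.const_mul _ ?_
  refine intervalIntegral.tendsto_integral_filter_of_dominated_convergence
    (fun ρ => ρ ^ α * ∫ y in G, |Γ x y| * M) (.of_forall fun k => ?_) (.of_forall fun k => ?_)
    ((intervalIntegral.intervalIntegrable_rpow' hα).mul_const _) ?_
  · refine AEStronglyMeasurable.mul (by fun_prop) (StronglyMeasurable.aestronglyMeasurable ?_)
    have hm : Measurable (Set.indicator {p : ℝ × EuclideanSpace ℝ (Fin n) | p.2 ∈ LBall Γ x p.1}
        fun p => (Γ x p.2 - 1 / p.1) * g k p.2) :=
      Measurable.indicator (by have := hg k; fun_prop) (measurableSet_LBall_prod hΓ)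
    convert hm.stronglyMeasurable.integral_prod_right' (ν := volume) using 2 with ρ
    exact (integral_indicator (measurableSet_LBall hΓ ρ)).symm
  · refine .of_forall fun ρ hρ => ?_
    rw [Set.uIoc_of_le hr.le] at hρ
    rw [norm_mul, Real.norm_of_nonneg (Real.rpow_nonneg hρ.1.le _)]
    refine mul_le_mul_of_nonneg_left ?_ (Real.rpow_nonneg hρ.1.le _)
    refine (norm_integral_le_of_norm_le (hint.mono_set (hsub hρ)) (hbd hρ k)).trans ?_
    exact setIntegral_mono_set hint (.of_forall fun y => mul_nonneg (abs_nonneg _) hM0)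
      (hsub hρ).eventuallyLE
  · refine .of_forall fun ρ hρ => ?_
    rw [Set.uIoc_of_le hr.le] at hρ
    refine Tendsto.const_mul _ (tendsto_integral_of_dominated_convergence _ (fun k => ?_)
      (hint.mono_set (hsub hρ)) (hbd hρ) (.of_forall fun y => (hlim y).const_mul _))
    have := hg k
    exact Measurable.aestronglyMeasurable (by fun_prop)

end LBall

lemma Nr_neg {n : ℕ} (Γ : EuclideanSpace ℝ (Fin n) → EuclideanSpace ℝ (Fin n) → ℝ) (α : ℝ)
    (w : EuclideanSpace ℝ (Fin n) → ℝ) (x : EuclideanSpace ℝ (Fin n)) (r : ℝ) :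
    Nr Γ α (fun y => -w y) x r = -Nr Γ α w x r := by
  simp only [Nr, mul_neg, integral_neg, intervalIntegral.integral_neg]

lemma integrableOn_Kker_of_Mr_one_ne_zero {n : ℕ}
    {Γ : EuclideanSpace ℝ (Fin n) → EuclideanSpace ℝ (Fin n) → ℝ}
    {A : EuclideanSpace ℝ (Fin n) → Matrix (Fin n) (Fin n) ℝ} {α : ℝ}
    {x : EuclideanSpace ℝ (Fin n)} {r : ℝ} (h : Mr Γ A α (fun _ => 1) x r ≠ 0) :
    IntegrableOn (Kker Γ A α x) (LBall Γ x r) := by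
  by_contra hK
  refine h ?_
  simp only [Mr, one_mul]
  rw [integral_undef hK, mul_zero]

/-- under the structural hypotheses on `A`, `Γ` and the hypotheses
(a) (representation formula for `C²` functions), (b) (potentials of smooth compactly
supported data solve `L u_g = −g`), (c) (uniform local integrability of `Γ`), the
potential `u_f` of any compactly supported continuous `f` satisfies
`u_f(x) = M_r(u_f)(x) + N_r(f)(x)` for all `x` and `r > 0`. -/
theorem potential_representation_formula {n : ℕ}
    (A : EuclideanSpace ℝ (Fin n) → Matrix (Fin n) (Fin n) ℝ)
    (hAsymm : ∀ x, (A x).IsSymm)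
    (hAsmooth : ∀ i j, ContDiff ℝ (⊤ : ℕ∞) fun x => A x i j)
    (hApsd : ∀ x, (A x).PosSemidef)
    (hAtrace : ∀ x, 0 < ∑ i : Fin n, A x i i)
    (Γ : EuclideanSpace ℝ (Fin n) → EuclideanSpace ℝ (Fin n) → ℝ)
    (hΓsmooth : ContDiffOn ℝ (⊤ : ℕ∞)
      (fun p : EuclideanSpace ℝ (Fin n) × EuclideanSpace ℝ (Fin n) => Γ p.1 p.2)
      {p | p.1 ≠ p.2})
    (hsymm : ∀ x y, x ≠ y → Γ x y = Γ y x)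
    (hpos : ∀ x y, x ≠ y → 0 < Γ x y)
    (hblow : ∀ y, Tendsto (fun x => Γ x y) (𝓝[≠] y) atTop)
    (hdecay : ∀ K : Set (EuclideanSpace ℝ (Fin n)), IsCompact K →
      Tendsto (fun x => ⨆ y : K, Γ x (y : EuclideanSpace ℝ (Fin n)))
        (Filter.cocompact _) (𝓝 0))
    (hloc : ∀ x, LocallyIntegrable (Γ x) volume)
    (α : ℝ) (hα : -1 < α)
    (hrep : ∀ u : EuclideanSpace ℝ (Fin n) → ℝ, ContDiff ℝ 2 u →
      ∀ (x : EuclideanSpace ℝ (Fin n)) (r : ℝ), 0 < r →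
        u x = Mr Γ A α u x r - Nr Γ α (Lop A u) x r)
    (hpot : ∀ g : EuclideanSpace ℝ (Fin n) → ℝ, ContDiff ℝ (⊤ : ℕ∞) g → HasCompactSupport g →
      ContDiff ℝ (⊤ : ℕ∞) (potential Γ g) ∧ ∀ x, Lop A (potential Γ g) x = -g x)
    (hsup : ∀ G K : Set (EuclideanSpace ℝ (Fin n)), IsCompact G → IsCompact K →
      ∃ C : ℝ, ∀ x ∈ G, (∫ y in K, Γ x y) ≤ C)
    (f : EuclideanSpace ℝ (Fin n) → ℝ) (hf : Continuous f) (hfs : HasCompactSupport f)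
    (x : EuclideanSpace ℝ (Fin n)) (r : ℝ) (hr : 0 < r) :
    potential Γ f x = Mr Γ A α (potential Γ f) x r + Nr Γ α f x r := by
  have hn : Nonempty (Fin n) := by
    by_contra hn
    rw [not_nonempty_iff] at hn
    simpa using hAtrace x
  have hmeas (z) : Measurable (Γ z) :=
    measurable_of_continuousOn_ne (continuousOn_section hΓsmooth.continuousOn z)
  have hne (z : EuclideanSpace ℝ (Fin n)) : ∀ᵐ y, y ≠ z := by
    simp [ae_iff]
  have hnonneg (z) : 0 ≤ᵐ[volume] Γ z := by
    filter_upwards [hne z] with y hy using (hpos z y hy.symm).le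
  obtain ⟨G, hG, hGr⟩ := LBall_subset_compact (x := x) hsymm
    (by simpa using hdecay {x} isCompact_singleton) hr
  have hK : IntegrableOn (Kker Γ A α x) (LBall Γ x r) := by
    refine integrableOn_Kker_of_Mr_one_ne_zero fun h0 => ?_
    have h := hrep (fun _ => 1) contDiff_const x r hr
    simp [h0, Lop, pd, Nr] at h
  obtain ⟨g, M, hg, hgs, hM, hlim⟩ := exists_smooth_approx hf hfs
  have hM0 : 0 ≤ M := (abs_nonneg _).trans (hM 0 x)
  obtain ⟨C, hC⟩ := hsup G (tsupport f) hG hfs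
  have hpotlim (z) : Tendsto (fun k => potential Γ (g k) z) atTop (𝓝 (potential Γ f z)) := by
    refine tendsto_integral_of_dominated_convergence
      (fun y => ‖Γ z y * (tsupport f).indicator (fun _ => M) y‖) (fun k => ?_)
      (integrable_mul_of_support_subset (hloc z) hfs (M := M) ?_ Set.support_indicator_subset
        fun y => ?_).norm
      (fun k => .of_forall fun y => ?_) (.of_forall fun y => (hlim y).const_mul _)
    · exact (hmeas z).aestronglyMeasurable.mul (hg k).continuous.aestronglyMeasurable
    · exact aestronglyMeasurable_const.indicator (isClosed_tsupport f).measurableSet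
    · by_cases hy : y ∈ tsupport f <;> simp [hy, abs_of_nonneg hM0, hM0]
    · rw [norm_mul, norm_mul]
      refine mul_le_mul_of_nonneg_left ?_ (norm_nonneg _)
      by_cases hy : y ∈ tsupport f
      · simpa [hy, abs_of_nonneg hM0] using hM k y
      · simp [Function.notMem_support.1 (mt (@hgs k y) hy)]
  have hgc (k : ℕ) : HasCompactSupport (g k) :=
    HasCompactSupport.of_support_subset_isCompact hfs (hgs k)
  have hMrlim : Tendsto (fun k => Mr Γ A α (potential Γ (g k)) x r) atTop
      (𝓝 (Mr Γ A α (potential Γ f) x r)) := by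
    refine Tendsto.const_mul _ (tendsto_integral_of_dominated_convergence
      (fun y => M * C * ‖Kker Γ A α x y‖) (fun k => ?_) (hK.norm.const_mul _) (fun k => ?_)
      (.of_forall fun y => (hpotlim y).mul_const _))
    · exact (hpot _ (hg k) (hgc k)).1.continuous.aestronglyMeasurable.mul hK.aestronglyMeasurable
    · filter_upwards [ae_restrict_mem (measurableSet_LBall (hmeas x) r)] with y hy
      rw [norm_mul]
      refine mul_le_mul_of_nonneg_right ?_ (norm_nonneg _)
      exact (abs_integral_mul_le_of_support_subset (hloc y) (hnonneg y) hfs (hgs k) (hM k)).trans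
        (mul_le_mul_of_nonneg_left (hC y (hGr hy)) hM0)
  have hNrlim := Nr_tendsto (hmeas x) (hloc x) hG hα hr hGr (hne x)
    (fun k => (hg k).continuous.measurable) hM hlim
  refine tendsto_nhds_unique (hpotlim x) ((hMrlim.add hNrlim).congr fun k => ?_)
  obtain ⟨hu, hLu⟩ := hpot _ (hg k) (hgc k)
  rw [hrep _ (hu.of_le (by norm_cast)) x r hr, funext hLu, Nr_neg, sub_neg_eq_add]
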